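/- Let A ∈ ℂ^{m×n} with m ≥ n, and let A = QR be its thin QR decomposition. Partition A = [A₁ A₂] and correspondingly R = [[R₁₁, R₁₂],[0, R₂₂]] where A₁ ∈ ℂ^{m×(n-k)} and R₂₂ ∈ ℂ^{k×k}. If σ_i(A) < σ_1(A₁) for i = 1,...,k (singular values in nondecreasing order, σ_1(A₁) being the smallest singular value of A₁), then σ_i(R₂₂) ≤ (σ_n(A)/σ_1(A₁) + 1) · σ_i(A) for i = 1,...,k. -/

import Mathlib

open Matrix

/-- squared Euclidean norm -/
noncomputable def sqN {ι : Type*} [Fintype ι] (x : ι → ℂ) : ℝ := ∑ i, ‖x i‖ ^ 2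

lemma sqN_nonneg {ι : Type*} [Fintype ι] (x : ι → ℂ) : 0 ≤ sqN x :=
  Finset.sum_nonneg fun _ _ => by positivity

lemma sqN_eq {ι : Type*} [Fintype ι] (x : ι → ℂ) : ((sqN x : ℝ) : ℂ) = star x ⬝ᵥ x := by
  simp only [sqN, dotProduct, Pi.star_apply, Complex.ofReal_sum]
  refine Finset.sum_congr rfl fun i _ => ?_
  have := Complex.conj_mul' (x i)
  simp [this]

lemma sqN_norm {ι : Type*} [Fintype ι] (x : ι → ℂ) : sqN x = ‖WithLp.toLp 2 x‖ ^ 2 := by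
  rw [EuclideanSpace.norm_sq_eq]; rfl

lemma sqN_isom {ι κ : Type*} [Fintype ι] [Fintype κ] [DecidableEq κ] (U : Matrix ι κ ℂ)
    (hU : Uᴴ * U = 1) (x : κ → ℂ) : sqN (U *ᵥ x) = sqN x := by
  have : ((sqN (U *ᵥ x) : ℝ) : ℂ) = (sqN x : ℝ) := by
    rw [sqN_eq, sqN_eq, star_mulVec, ← dotProduct_mulVec, mulVec_mulVec, hU, one_mulVec]
  exact_mod_cast this

lemma sqN_svd {ι κ : Type*} [Fintype ι] [Fintype κ] [DecidableEq κ] (A U : Matrix ι κ ℂ)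
    (V : Matrix κ κ ℂ) (s : κ → ℝ) (hU : Uᴴ * U = 1)
    (h : A = U * Matrix.diagonal (fun i => (s i : ℂ)) * Vᴴ) (x : κ → ℂ) :
    sqN (A *ᵥ x) = ∑ j, s j ^ 2 * ‖(Vᴴ *ᵥ x) j‖ ^ 2 := by
  rw [h, ← mulVec_mulVec, ← mulVec_mulVec, sqN_isom U hU, sqN]
  refine Finset.sum_congr rfl fun j _ => ?_
  rw [mulVec_diagonal, norm_mul, mul_pow]
  simp

lemma sqN_V {κ : Type*} [Fintype κ] [DecidableEq κ] (V : Matrix κ κ ℂ) (hV : Vᴴ * V = 1)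
    (x : κ → ℂ) : sqN (Vᴴ *ᵥ x) = sqN x := by
  apply sqN_isom
  rw [conjTranspose_conjTranspose]
  exact mul_eq_one_comm.mp hV

lemma svd_le {ι κ : Type*} [Fintype ι] [Fintype κ] [DecidableEq κ] (A U : Matrix ι κ ℂ)
    (V : Matrix κ κ ℂ) (s : κ → ℝ) (hs : ∀ i, 0 ≤ s i) (hU : Uᴴ * U = 1) (hV : Vᴴ * V = 1)
    (h : A = U * Matrix.diagonal (fun i => (s i : ℂ)) * Vᴴ) (x : κ → ℂ) (t : ℝ)
    (ht : ∀ j, s j ≤ t ∨ (Vᴴ *ᵥ x) j = 0) : sqN (A *ᵥ x) ≤ t ^ 2 * sqN x := by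
  rw [sqN_svd A U V s hU h, ← sqN_V V hV x, sqN, Finset.mul_sum]
  refine Finset.sum_le_sum fun j _ => ?_
  rcases ht j with h1 | h1
  · have := hs j
    gcongr
  · simp [h1]

lemma svd_ge {ι κ : Type*} [Fintype ι] [Fintype κ] [DecidableEq κ] (A U : Matrix ι κ ℂ)
    (V : Matrix κ κ ℂ) (s : κ → ℝ) (hU : Uᴴ * U = 1) (hV : Vᴴ * V = 1)
    (h : A = U * Matrix.diagonal (fun i => (s i : ℂ)) * Vᴴ) (x : κ → ℂ) (t : ℝ) (ht0 : 0 ≤ t)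
    (ht : ∀ j, t ≤ s j ∨ (Vᴴ *ᵥ x) j = 0) : t ^ 2 * sqN x ≤ sqN (A *ᵥ x) := by
  rw [sqN_svd A U V s hU h, ← sqN_V V hV x, sqN, Finset.mul_sum]
  refine Finset.sum_le_sum fun j _ => ?_
  rcases ht j with h1 | h1
  · gcongr
  · simp [h1]

lemma sum_split {M : Type*} [AddCommMonoid M] (n r k : ℕ) (h : r + k = n) (f : Fin n → M) :
    ∑ j, f j = ∑ j : Fin r, f (Fin.castLE (by omega) j)
      + ∑ j : Fin k, f ⟨r + (j : ℕ), by have := j.2; omega⟩ := by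
  subst h
  rw [Fin.sum_univ_add]
  rfl

lemma sqN_add_ge {ι : Type*} [Fintype ι] (p c : ι → ℂ) :
    (√(sqN p) - √(sqN c)) ^ 2 ≤ sqN (p + c) := by
  simp only [sqN_norm, Real.sqrt_sq (norm_nonneg _)]
  rw [sq_le_sq, abs_of_nonneg (norm_nonneg (WithLp.toLp 2 (p + c)))]
  have := abs_norm_sub_norm_le (WithLp.toLp 2 p) (-WithLp.toLp 2 c)
  rw [norm_neg, sub_neg_eq_add] at this
  exact this

/-- the scalar inequality; `a, b, q` are squared norms -/
lemma scalar_core (s N σ ρ a b q P C : ℝ) (hσ : 0 ≤ σ) (hσs : σ < s) (hN : 0 ≤ N)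
    (hρ : (N / s + 1) * σ < ρ) (ha : 0 ≤ a) (hb : 0 ≤ b) (hab : 0 < a + b)
    (hP : s ^ 2 * a ≤ P ^ 2) (hC : C ^ 2 + q ≤ N ^ 2 * b) (hq : ρ ^ 2 * b ≤ q)
    (hA : (P - C) ^ 2 + q ≤ σ ^ 2 * (a + b)) : False := by
  have hs : 0 < s := lt_of_le_of_lt hσ hσs
  obtain ⟨t, rfl⟩ : ∃ t, σ = t * s := ⟨σ / s, by field_simp⟩
  have ht0 : 0 ≤ t := by
    by_contra h
    push Not at h
    nlinarith
  have ht1 : t < 1 := by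
    by_contra h
    push Not at h
    nlinarith
  have e : (N / s + 1) * (t * s) = t * N + t * s := by field_simp
  rw [e] at hρ
  have h0 : 0 ≤ t * N := mul_nonneg ht0 hN
  have hρ2 : (t * N) ^ 2 + (t * s) ^ 2 < ρ ^ 2 := by nlinarith
  have hq0 : 0 ≤ q := le_trans (by positivity) hq
  have ht2 : 0 < 1 - t ^ 2 := by nlinarith
  rcases hb.eq_or_lt with hb0 | hb0
  · subst hb0
    have hC0 : C = 0 := by nlinarith [sq_nonneg C]
    subst hC0
    have ha0 : 0 < a := by linarith
    have : 0 < s ^ 2 * a := by positivity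
    nlinarith
  · have h1 : (P - C) ^ 2 + q ≤ t ^ 2 * P ^ 2 + (t * s) ^ 2 * b := by
      nlinarith [mul_le_mul_of_nonneg_left hP (sq_nonneg t)]
    have h2 : ((t * N) ^ 2 + (t * s) ^ 2) * b < q :=
      lt_of_lt_of_le (mul_lt_mul_of_pos_right hρ2 hb0) hq
    have h3 : t ^ 2 * C ^ 2 < (1 - t ^ 2) * (q - (t * s) ^ 2 * b) := by
      have h4 := mul_le_mul_of_nonneg_left hC (sq_nonneg t)
      have h5 : 0 ≤ t ^ 2 * ((t * s) ^ 2 * b) := by positivity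
      nlinarith
    have h6 := mul_le_mul_of_nonneg_left h1 ht2.le
    nlinarith [sq_nonneg ((1 - t ^ 2) * P - C)]

/-- Lemma 3: if `A = QR` is the thin QR decomposition of `A ∈ ℂ^{m×n}`, `A₁` are the
first `n-k` columns of `A`, `R₂₂` is the lower-right `k×k` block of `R`, and
`σ_i(A) < σ_1(A₁)` for `i = 1,...,k`, then
`σ_i(R₂₂) ≤ (σ_n(A)/σ_1(A₁) + 1) σ_i(A)` for `i = 1,...,k`.
Singular values (nondecreasing) are specified via (thin) singular value decompositions. -/
theorem stmt5 (m n k : ℕ) (hmn : n ≤ m) (hk1 : 1 ≤ k) (hk : k < n)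
    (A Q : Matrix (Fin m) (Fin n) ℂ) (R : Matrix (Fin n) (Fin n) ℂ)
    (hQR : A = Q * R) (hQ : Qᴴ * Q = 1)
    (hRtri : ∀ i j : Fin n, (j : ℕ) < (i : ℕ) → R i j = 0)
    -- thin SVD of A, giving the singular values σA (nondecreasing)
    (σA : Fin n → ℝ) (hA1 : Monotone σA) (hA2 : ∀ i, 0 ≤ σA i)
    (UA : Matrix (Fin m) (Fin n) ℂ) (VA : Matrix (Fin n) (Fin n) ℂ)
    (hUA : UAᴴ * UA = 1) (hVA : VAᴴ * VA = 1)
    (hsvdA : A = UA * Matrix.diagonal (fun i => (σA i : ℂ)) * VAᴴ)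
    -- thin SVD of A₁ (the first n-k columns of A), giving σA1 (nondecreasing)
    (σA1 : Fin (n - k) → ℝ) (hA11 : Monotone σA1) (hA12 : ∀ i, 0 ≤ σA1 i)
    (UA1 : Matrix (Fin m) (Fin (n - k)) ℂ) (VA1 : Matrix (Fin (n - k)) (Fin (n - k)) ℂ)
    (hUA1 : UA1ᴴ * UA1 = 1) (hVA1 : VA1ᴴ * VA1 = 1)
    (hsvdA1 : A.submatrix id (Fin.castLE (Nat.sub_le n k)) =
      UA1 * Matrix.diagonal (fun i => (σA1 i : ℂ)) * VA1ᴴ)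
    -- SVD of R₂₂ (the lower-right k×k block of R), giving σR (nondecreasing)
    (σR : Fin k → ℝ) (hR1 : Monotone σR) (hR2 : ∀ i, 0 ≤ σR i)
    (UR VR : Matrix (Fin k) (Fin k) ℂ)
    (hUR : URᴴ * UR = 1) (hVR : VRᴴ * VR = 1)
    (hsvdR : R.submatrix (fun i : Fin k => (⟨n - k + (i : ℕ), by have := i.2; omega⟩ : Fin n))
        (fun j : Fin k => (⟨n - k + (j : ℕ), by have := j.2; omega⟩ : Fin n)) =
      UR * Matrix.diagonal (fun i => (σR i : ℂ)) * VRᴴ)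
    -- hypothesis: σ_i(A) < σ_1(A₁) for i = 1,...,k
    (hlt : ∀ i : Fin k, σA (Fin.castLE hk.le i) < σA1 ⟨0, by omega⟩) :
    ∀ i : Fin k,
      σR i ≤ (σA ⟨n - 1, by omega⟩ / σA1 ⟨0, by omega⟩ + 1) * σA (Fin.castLE hk.le i) := by
  intro i
  by_contra hcon
  push Not at hcon
  have hrk : n - k + k = n := by omega
  have hr0 : 0 < n - k := by omega
  set e1 : Fin (n - k) → Fin n := Fin.castLE (Nat.sub_le n k) with he1
  set e2 : Fin k → Fin n := fun i => ⟨n - k + (i : ℕ), by have := i.2; omega⟩ with he2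
  have hsum : ∀ {M : Type} [AddCommMonoid M] (f : Fin n → M),
      ∑ j, f j = ∑ j, f (e1 j) + ∑ j, f (e2 j) := fun f => sum_split n (n - k) k hrk f
  set i' : Fin n := Fin.castLE hk.le i with hi'
  have key : ∀ y : Fin n → ℂ, sqN (A *ᵥ y) =
      sqN (R.submatrix e1 e1 *ᵥ (y ∘ e1) + R.submatrix e1 e2 *ᵥ (y ∘ e2))
        + sqN (R.submatrix e2 e2 *ᵥ (y ∘ e2)) := by
    intro y
    rw [hQR, ← mulVec_mulVec, sqN_isom Q hQ, sqN, hsum]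
    congr 1
    · refine Finset.sum_congr rfl fun j _ => ?_
      simp only [mulVec, dotProduct, Pi.add_apply]
      rw [hsum]
      rfl
    · refine Finset.sum_congr rfl fun j _ => ?_
      simp only [mulVec, dotProduct]
      rw [hsum, Finset.sum_eq_zero, zero_add]
      · rfl
      · intro l _
        rw [hRtri, zero_mul]
        have := l.2
        simp only [he1, he2, Fin.val_castLE]
        omega
  -- choose x
  let L : (Fin n → ℂ) →ₗ[ℂ] ({j : Fin n // j ≠ i'} → ℂ) := LinearMap.pi fun j =>
    if h : (j.1 : ℕ) < i then
      LinearMap.proj (⟨j.1, by have := i.2; omega⟩ : Fin k) ∘ₗ VRᴴ.mulVecLin ∘ₗ LinearMap.funLeft ℂ ℂ e2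
    else LinearMap.proj j.1 ∘ₗ VAᴴ.mulVecLin
  have hker : LinearMap.ker L ≠ ⊥ := by
    apply LinearMap.ker_ne_bot_of_finrank_lt
    rw [Module.finrank_fintype_fun_eq_card, Module.finrank_fintype_fun_eq_card]
    exact Fintype.card_subtype_lt (x := i') (by simp)
  obtain ⟨x, hx, hx0⟩ := (Submodule.ne_bot_iff _).mp hker
  rw [LinearMap.mem_ker] at hx
  have hxA : ∀ j, σA j ≤ σA i' ∨ (VAᴴ *ᵥ x) j = 0 := by
    intro j
    by_cases hj : j ≤ i'
    · exact Or.inl (hA1 hj)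
    · right
      push Not at hj
      have h1 := congrFun hx ⟨j, hj.ne'⟩
      have h2 : ¬ ((j : ℕ) < i) := by
        have : (i' : ℕ) < j := hj
        simp only [hi', Fin.val_castLE] at this
        omega
      simpa [L, h2] using h1
  have hxR : ∀ j, σR i ≤ σR j ∨ (VRᴴ *ᵥ (x ∘ e2)) j = 0 := by
    intro j
    by_cases hj : i ≤ j
    · exact Or.inl (hR1 hj)
    · right
      push Not at hj
      have hj' : (j : ℕ) < i := hj
      have h1 := congrFun hx ⟨Fin.castLE hk.le j, by
        intro h
        have := congrArg Fin.val h
        simp only [hi', Fin.val_castLE] at this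
        omega⟩
      simpa [L, hj', LinearMap.funLeft] using h1
  have hxpos : 0 < sqN (x ∘ e1) + sqN (x ∘ e2) := by
    have h1 : sqN x = sqN (x ∘ e1) + sqN (x ∘ e2) := hsum _
    rw [← h1, sqN_norm]
    have : WithLp.toLp 2 x ≠ 0 := by simpa using hx0
    positivity
  -- head and tail of x
  have hhead : sqN (A.submatrix id e1 *ᵥ (x ∘ e1)) = sqN (R.submatrix e1 e1 *ᵥ (x ∘ e1)) := by
    have h := key (fun j => if (j : ℕ) < n - k then x j else 0)
    have a1 : (fun j : Fin n => if (j : ℕ) < n - k then x j else 0) ∘ e1 = x ∘ e1 := by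
      funext j; simp [he1]
    have a2 : (fun j : Fin n => if (j : ℕ) < n - k then x j else 0) ∘ e2 = 0 := by
      funext j; simp [he2]
    have a3 : A *ᵥ (fun j : Fin n => if (j : ℕ) < n - k then x j else 0)
        = A.submatrix id e1 *ᵥ (x ∘ e1) := by
      funext l
      simp only [mulVec, dotProduct]
      rw [hsum]
      simp [he1, he2]
    rw [a1, a2, a3] at h
    rw [h]
    simp [sqN]
  have htail : sqN (R.submatrix e1 e2 *ᵥ (x ∘ e2)) + sqN (R.submatrix e2 e2 *ᵥ (x ∘ e2))
      ≤ σA ⟨n - 1, by omega⟩ ^ 2 * sqN (x ∘ e2) := by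
    have h := key (fun j => if (j : ℕ) < n - k then 0 else x j)
    have a1 : (fun j : Fin n => if (j : ℕ) < n - k then 0 else x j) ∘ e1 = 0 := by
      funext j; simp [he1]
    have a2 : (fun j : Fin n => if (j : ℕ) < n - k then 0 else x j) ∘ e2 = x ∘ e2 := by
      funext j; simp [he2]
    have a3 : sqN (fun j : Fin n => if (j : ℕ) < n - k then 0 else x j) = sqN (x ∘ e2) := by
      rw [sqN, hsum]
      simp [he1, he2, sqN]
    rw [a1, a2, mulVec_zero, zero_add] at h
    rw [← h, ← a3]
    refine svd_le A UA VA σA hA2 hUA hVA hsvdA _ _ fun j => Or.inl (hA1 ?_)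
    rw [Fin.le_def]
    have := j.2
    simp only
    omega
  have hP := svd_ge _ UA1 VA1 σA1 hUA1 hVA1 hsvdA1 (x ∘ e1) (σA1 ⟨0, hr0⟩) (hA12 _)
    (fun j => Or.inl (hA11 (by rw [Fin.le_def]; simp)))
  rw [hhead] at hP
  have hq := svd_ge _ UR VR σR hUR hVR hsvdR (x ∘ e2) (σR i) (hR2 _) hxR
  have hA := svd_le A UA VA σA hA2 hUA hVA hsvdA x (σA i') hxA
  have h1 : sqN x = sqN (x ∘ e1) + sqN (x ∘ e2) := hsum _
  rw [key, h1] at hA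
  have hadd := sqN_add_ge (R.submatrix e1 e1 *ᵥ (x ∘ e1)) (R.submatrix e1 e2 *ᵥ (x ∘ e2))
  refine scalar_core (σA1 ⟨0, hr0⟩) (σA ⟨n - 1, by omega⟩) (σA i') (σR i)
    (sqN (x ∘ e1)) (sqN (x ∘ e2)) (sqN (R.submatrix e2 e2 *ᵥ (x ∘ e2)))
    (√(sqN (R.submatrix e1 e1 *ᵥ (x ∘ e1)))) (√(sqN (R.submatrix e1 e2 *ᵥ (x ∘ e2))))
    (hA2 _) (hlt i) (hA2 _) hcon (sqN_nonneg _) (sqN_nonneg _) hxpos ?_ ?_ hq ?_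
  · rw [Real.sq_sqrt (sqN_nonneg _)]; exact hP
  · rw [Real.sq_sqrt (sqN_nonneg _)]; exact htail
  · linarith
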